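/- arXiv:2212.06422 — 5 statements merged into one kernel-verified Lean document; each statement's English description precedes it below -/
import Mathlib

section
/- Let λ ≥ 2 be a real number and let Y be a Poisson random variable with parameter λ. Then E[|Y − λ|] ≥ (1/(√π · e^{1/12}))·√λ. -/
open MeasureTheory ProbabilityTheory Real
open scoped ENNReal NNReal

/-- The first moment of the Poisson distribution, as a series. -/
lemma hasSum_poisson_mul_id (r : ℝ≥0) :
    HasSum (fun n : ℕ ↦ exp (-r) * (r : ℝ) ^ n / n.factorial * n) r := by
  rw [← hasSum_nat_add_iff' 1]
  have h := (hasSum_one_poissonMeasure r).mul_left (r : ℝ)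
  simp only [Finset.sum_range_one, Nat.cast_zero, mul_zero, sub_zero]
  rw [mul_one] at h
  convert! h using 2 with n
  rw [Nat.factorial_succ, pow_succ]
  push_cast
  field_simp

/-- The lower partial first central moment of the Poisson distribution telescopes. -/
lemma sum_range_poisson_mul_sub (r : ℝ) (m : ℕ) :
    ∑ n ∈ Finset.range (m + 1), exp (-r) * r ^ n / n.factorial * (r - n) =
      exp (-r) * r ^ (m + 1) / m.factorial := by
  induction m with
  | zero => simp
  | succ m ih =>
    rw [Finset.sum_range_succ, ih, Nat.factorial_succ, pow_succ r (m + 1)]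
    push_cast
    field_simp
    ring

/-- Cutting the mean absolute deviation of a Poisson variable at any level bounds it below. -/
lemma two_mul_le_integral_abs_sub_poissonMeasure (r : ℝ≥0) (m : ℕ) :
    2 * (exp (-r) * (r : ℝ) ^ (m + 1) / m.factorial) ≤
      ∫ y, |(y : ℝ) - (r : ℝ)| ∂(poissonMeasure r) := by
  set p : ℕ → ℝ := fun n ↦ exp (-r) * (r : ℝ) ^ n / n.factorial with hp
  have hp0 (n : ℕ) : 0 ≤ p n := by positivity
  have hc : HasSum (fun n : ℕ ↦ p n * n - p n * r) 0 := by
    simpa [hp] using (hasSum_poisson_mul_id r).sub ((hasSum_one_poissonMeasure r).mul_right (r : ℝ))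
  have hfin : HasSum (fun n : ℕ ↦ if n ∈ Finset.range (m + 1) then p n * (r - n) else 0)
      (exp (-r) * (r : ℝ) ^ (m + 1) / m.factorial) := by
    rw [← sum_range_poisson_mul_sub, ← Finset.sum_congr rfl fun n hn ↦ if_pos hn]
    exact hasSum_sum_of_ne_finset_zero fun n hn ↦ if_neg hn
  have habs : Summable fun n : ℕ ↦ p n * |(n : ℝ) - r| := by
    refine hc.summable.abs.congr fun n ↦ ?_
    rw [← mul_sub, abs_mul, abs_of_nonneg (hp0 n)]
  rw [integral_poissonMeasure]
  simp only [smul_eq_mul]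
  have h := hc.add (hfin.mul_left 2)
  rw [zero_add] at h
  refine hasSum_le (fun n ↦ ?_) h habs.hasSum
  split_ifs
  · nlinarith [hp0 n, neg_abs_le ((n : ℝ) - r)]
  · nlinarith [hp0 n, le_abs_self ((n : ℝ) - r)]

/-- The upper Stirling bound with the constant error factor `e ^ (1 / 12)`. -/
lemma factorial_le_stirling_of_two_le {m : ℕ} (hm : 2 ≤ m) :
    (m.factorial : ℝ) ≤ √π * exp (1 / 12) * (√(2 * m) * (m / exp 1) ^ m) := by
  have hanti : Stirling.stirlingSeq m ≤ Stirling.stirlingSeq 2 := by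
    obtain ⟨k, rfl⟩ := Nat.exists_eq_add_of_le hm
    have := Stirling.stirlingSeq'_antitone (show 1 ≤ 1 + k by lia)
    rwa [Function.comp_apply, Function.comp_apply, show (1 + k).succ = 2 + k by lia] at this
  have htwo : Stirling.stirlingSeq 2 = exp 1 ^ 2 / 4 := by
    have : √(4 : ℝ) = 2 := by rw [show (4 : ℝ) = 2 ^ 2 by norm_num]; simp
    simp only [Stirling.stirlingSeq]
    rw [Nat.factorial_two, Nat.cast_two, show (2 : ℝ) * 2 = 4 by norm_num, this]
    field_simp
    norm_num
  have hpi : (1.772 : ℝ) ≤ √π := by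
    apply Real.le_sqrt_of_sq_le
    linarith [pi_gt_d4]
  have hexp : (1 : ℝ) + 1 / 12 ≤ exp (1 / 12) := by linarith [add_one_le_exp (1 / 12 : ℝ)]
  have hbound : Stirling.stirlingSeq m ≤ √π * exp (1 / 12) := by
    have h1 : exp 1 ^ 2 ≤ 2.7182818286 ^ 2 := by gcongr; exact exp_one_lt_d9.le
    have h2 : 1.772 * (1 + 1 / 12) ≤ √π * exp (1 / 12) := by gcongr
    rw [htwo] at hanti
    linarith
  have hm0 : (0 : ℝ) < m := by positivity
  rw [Stirling.stirlingSeq, div_le_iff₀ (by positivity)] at hbound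
  exact hbound

lemma div_pow_mul_exp_sub_le_sqrt_two {r : ℝ} {m : ℕ} (hm : 2 ≤ m) (h₁ : m ≤ r)
    (h₂ : r ≤ m + 1) : (m / r) ^ m * exp (r - m) ≤ √2 := by
  have hm' : (2 : ℝ) ≤ m := by exact_mod_cast hm
  have hr : 0 < r := by linarith
  calc (m / r) ^ m * exp (r - m) ≤ exp (m / r - 1) ^ m * exp (r - m) := by
        gcongr
        linarith [add_one_le_exp (m / r - 1)]
    _ = exp (m * (m / r - 1) + (r - m)) := by rw [exp_add, exp_nat_mul]
    _ ≤ exp (1 / 3) := by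
        gcongr
        have : m * (m / r - 1) + (r - m) = (r - m) ^ 2 / r := by field_simp; ring
        rw [this, div_le_iff₀ hr]
        nlinarith
    _ ≤ √2 := by
        refine Real.le_sqrt_of_sq_le ?_
        refine le_of_pow_le_pow_left₀ (n := 3) (by norm_num) (by norm_num) ?_
        rw [← pow_mul, mul_comm, pow_mul, ← exp_nat_mul,
          show ((3 : ℕ) : ℝ) * (1 / 3) = 1 by norm_num]
        nlinarith [exp_one_lt_d9, exp_pos 1]

/-- If `Y ∼ Poisson(λ)` with `λ ≥ 2`, then
`𝔼[|Y − λ|] ≥ (1/(√π e^{1/12})) √λ`. -/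
theorem poisson_abs_dev_ge (lam : ℝ≥0) (hlam : 2 ≤ (lam : ℝ)) :
    (1 / (Real.sqrt Real.pi * Real.exp (1 / 12))) * Real.sqrt lam ≤
      ∫ y, |(y : ℝ) - (lam : ℝ)| ∂(poissonMeasure lam) := by
  set r : ℝ := (lam : ℝ) with hr
  set m := ⌊r⌋₊
  have hm : 2 ≤ m := Nat.le_floor (by exact_mod_cast hlam)
  have h₁ : (m : ℝ) ≤ r := Nat.floor_le (by linarith)
  have h₂ : r ≤ m + 1 := (Nat.lt_floor_add_one r).le
  have hr0 : 0 < r := by linarith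
  refine le_trans ?_ (two_mul_le_integral_abs_sub_poissonMeasure lam m)
  rw [← hr, one_div_mul_eq_div, ← mul_div_assoc, div_le_div_iff₀ (by positivity) (by positivity)]
  have hpow : ((m : ℝ) / exp 1) ^ m ≤ √2 * (exp (-r) * r ^ m) := by
    have h := mul_le_mul_of_nonneg_right (div_pow_mul_exp_sub_le_sqrt_two hm h₁ h₂)
      (show 0 ≤ exp (-r) * r ^ m by positivity)
    refine le_of_eq_of_le ?_ h
    rw [div_pow, div_pow, ← exp_nat_mul, exp_sub, exp_neg, mul_one]
    field_simp
  have hsqrt : √r * √(2 * m) ≤ √2 * r := by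
    rw [← Real.sqrt_mul hr0.le]
    refine Real.sqrt_le_iff.2 ⟨by positivity, ?_⟩
    rw [mul_pow, Real.sq_sqrt (by norm_num)]
    nlinarith
  calc √r * m.factorial
      ≤ √r * (√π * exp (1 / 12) * (√(2 * m) * (m / exp 1) ^ m)) := by
        gcongr
        exact factorial_le_stirling_of_two_le hm
    _ = √π * exp (1 / 12) * ((√r * √(2 * m)) * (m / exp 1) ^ m) := by ring
    _ ≤ √π * exp (1 / 12) * ((√2 * r) * (√2 * (exp (-r) * r ^ m))) := by gcongr
    _ = √2 ^ 2 * (exp (-r) * r ^ (m + 1)) * (√π * exp (1 / 12)) := by ring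
    _ = 2 * (exp (-r) * r ^ (m + 1)) * (√π * exp (1 / 12)) := by
        rw [Real.sq_sqrt (by norm_num)]
end

section
/- Let λ > 0 be a real number and let Y be a Poisson random variable with parameter λ. Then the mean absolute deviation of Y from λ is E[|Y − λ|] = 2·λ^{⌊λ⌋+1}·e^{−λ}/⌊λ⌋!. -/
open MeasureTheory ProbabilityTheory
open scoped ENNReal NNReal

/-- The Poisson weights `p n` satisfy `p n * (r - n) = (n + 1) * p (n + 1) - n * p n`. -/
lemma poisson_weight_mul_sub (r : ℝ) (n : ℕ) :
    Real.exp (-r) * r ^ n / (n.factorial : ℝ) * (r - n) =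
      ((n + 1 : ℕ) : ℝ) * (Real.exp (-r) * r ^ (n + 1) / ((n + 1).factorial : ℝ)) -
        n * (Real.exp (-r) * r ^ n / (n.factorial : ℝ)) := by
  have hn : (n.factorial : ℝ) ≠ 0 := by positivity
  have hn' : (n : ℝ) + 1 ≠ 0 := by positivity
  rw [Nat.factorial_succ]
  push_cast
  field_simp
  ring

lemma sum_range_poisson_weight_mul_sub (r : ℝ) (n : ℕ) :
    ∑ i ∈ Finset.range n, Real.exp (-r) * r ^ i / (i.factorial : ℝ) * (r - i) =
      n * (Real.exp (-r) * r ^ n / (n.factorial : ℝ)) := by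
  simp_rw [poisson_weight_mul_sub]
  rw [Finset.sum_range_sub fun i : ℕ ↦
    (i : ℝ) * (Real.exp (-r) * r ^ i / (i.factorial : ℝ))]
  simp

lemma sum_range_poisson_weight_mul_abs {r : ℝ} (hr : 0 ≤ r) (k : ℕ) :
    ∑ i ∈ Finset.range (k + (⌊r⌋₊ + 1)),
        Real.exp (-r) * r ^ i / (i.factorial : ℝ) * |(i : ℝ) - r| =
      2 * ((⌊r⌋₊ + 1 : ℕ) *
          (Real.exp (-r) * r ^ (⌊r⌋₊ + 1) / ((⌊r⌋₊ + 1).factorial : ℝ))) -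
        (k + (⌊r⌋₊ + 1) : ℕ) *
          (Real.exp (-r) * r ^ (k + (⌊r⌋₊ + 1)) / ((k + (⌊r⌋₊ + 1)).factorial : ℝ)) := by
  induction k with
  | zero =>
    rw [zero_add, ← sum_range_poisson_weight_mul_sub, two_mul, add_sub_cancel_right]
    refine Finset.sum_congr rfl fun i hi ↦ ?_
    have h : (i : ℝ) ≤ r :=
      (Nat.le_floor_iff hr).1 (Nat.lt_succ_iff.1 (Finset.mem_range.1 hi))
    rw [abs_of_nonpos (by linarith), neg_sub]
  | succ k ih =>
    have h : r ≤ ((k + (⌊r⌋₊ + 1) : ℕ) : ℝ) := by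
      have := Nat.lt_floor_add_one r
      push_cast
      linarith [k.cast_nonneg (α := ℝ)]
    rw [add_right_comm, Finset.sum_range_succ, ih, abs_of_nonneg (by linarith)]
    linear_combination -poisson_weight_mul_sub r (k + (⌊r⌋₊ + 1))

lemma succ_mul_poisson_weight_succ (r : ℝ) (n : ℕ) :
    ((n + 1 : ℕ) : ℝ) * (Real.exp (-r) * r ^ (n + 1) / ((n + 1).factorial : ℝ)) =
      r * (Real.exp (-r) * r ^ n / (n.factorial : ℝ)) := by
  linear_combination -poisson_weight_mul_sub r n

lemma hasSum_poisson_weight_mul_abs (r : ℝ≥0) :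
    HasSum (fun n : ℕ ↦ Real.exp (-r) * (r : ℝ) ^ n / (n.factorial : ℝ) * |(n : ℝ) - r|)
      (2 * (r * (Real.exp (-r) * (r : ℝ) ^ ⌊(r : ℝ)⌋₊ / (⌊(r : ℝ)⌋₊.factorial : ℝ)))) := by
  rw [hasSum_iff_tendsto_nat_of_nonneg fun n ↦ by positivity,
    ← Filter.tendsto_add_atTop_iff_nat (⌊(r : ℝ)⌋₊ + 1)]
  simp_rw [sum_range_poisson_weight_mul_abs r.coe_nonneg, ← add_assoc,
    succ_mul_poisson_weight_succ]
  have h := ((Filter.tendsto_add_atTop_iff_nat ⌊(r : ℝ)⌋₊).2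
    (hasSum_one_poissonMeasure r).summable.tendsto_atTop_zero).const_mul (r : ℝ)
  simpa using h.const_sub
    (2 * (r * (Real.exp (-r) * (r : ℝ) ^ ⌊(r : ℝ)⌋₊ / (⌊(r : ℝ)⌋₊.factorial : ℝ))))

/-- If `Y ∼ Poisson(λ)` with `λ > 0`, then the mean absolute deviation of `Y`
from `λ` is `𝔼[|Y − λ|] = 2 λ^{⌊λ⌋+1} e^{−λ} / ⌊λ⌋!`. -/
theorem poisson_abs_dev_eq (lam : ℝ≥0) (hlam : 0 < lam) :
    ∫ y, |(y : ℝ) - (lam : ℝ)| ∂(poissonMeasure lam) =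
      2 * (lam : ℝ) ^ (Nat.floor (lam : ℝ) + 1) * Real.exp (-(lam : ℝ)) /
        (Nat.factorial (Nat.floor (lam : ℝ)) : ℝ) := by
  rw [integral_poissonMeasure]
  simp_rw [smul_eq_mul]
  rw [(hasSum_poisson_weight_mul_abs lam).tsum_eq]
  ring
end

section
/- Let m, N be positive integers with λ = m/N ≥ 2, let c₁ = 1/(√π · e^{1/12}), and let Y_1, ..., Y_N be independent Poisson random variables each with parameter λ = m/N. Then E[Σ_{j=1}^N |Y_j − m/N|] ≥ c₁·√(mN) and Var(Σ_{j=1}^N |Y_j − m/N|) ≤ m. -/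
open MeasureTheory ProbabilityTheory
open scoped ENNReal NNReal

open scoped Nat

namespace PoissonAbsDev

theorem hasSum_poisson_mul_natCast {r : ℝ≥0} {f : ℕ → ℝ} {a : ℝ}
    (h : HasSum (fun n : ℕ ↦ Real.exp (-r) * r ^ n / (n)! * f (n + 1)) a) :
    HasSum (fun n : ℕ ↦ Real.exp (-r) * r ^ n / (n)! * (n * f n)) (r * a) := by
  rw [← hasSum_nat_add_iff' 1]
  simp only [Finset.sum_range_one, Nat.cast_zero, zero_mul, mul_zero, sub_zero]
  refine (h.mul_left (r : ℝ)).congr_fun fun n ↦ ?_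
  rw [Nat.factorial_succ]
  push_cast
  field_simp
  ring

theorem hasSum_poisson_natCast (r : ℝ≥0) :
    HasSum (fun n : ℕ ↦ Real.exp (-r) * r ^ n / (n)! * (n : ℝ)) r := by
  have h := hasSum_poisson_mul_natCast (r := r) (f := fun _ ↦ 1)
    (by simpa using hasSum_one_poissonMeasure r)
  simpa only [mul_one] using h

theorem hasSum_poisson_sub_sq (r : ℝ≥0) :
    HasSum (fun n : ℕ ↦ Real.exp (-r) * r ^ n / (n)! * ((n : ℝ) - r) ^ 2) r := by
  have h0 := hasSum_one_poissonMeasure r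
  have h1 := hasSum_poisson_natCast r
  have h2 := hasSum_poisson_mul_natCast (r := r) (f := fun n ↦ (n : ℝ))
    ((h1.add h0).congr_fun fun n ↦ by push_cast; ring)
  have h := (h2.sub (h1.mul_left (2 * (r : ℝ)))).add (h0.mul_left ((r : ℝ) ^ 2))
  rw [show (r : ℝ) * (r + 1) - 2 * r * r + r ^ 2 * 1 = r by ring] at h
  exact h.congr_fun fun n ↦ by ring

theorem sum_range_poisson_sub (r : ℝ≥0) (k : ℕ) :
    ∑ n ∈ Finset.range (k + 1), Real.exp (-r) * r ^ n / (n)! * ((r : ℝ) - n) =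
      r * (Real.exp (-r) * r ^ k / (k)!) := by
  induction k with
  | zero => simp; ring
  | succ k ih =>
    rw [Finset.sum_range_succ, ih, Nat.factorial_succ]
    push_cast
    field_simp
    ring

/-- De Moivre's formula for the mean absolute deviation of a Poisson variable. -/
theorem hasSum_poisson_abs_sub (r : ℝ≥0) :
    HasSum (fun n : ℕ ↦ Real.exp (-r) * r ^ n / (n)! * |(n : ℝ) - r|)
      (2 * (r * (Real.exp (-r) * r ^ ⌊(r : ℝ)⌋₊ / (⌊(r : ℝ)⌋₊)!))) := by
  have hlt (n : ℕ) : n ∈ Finset.range (⌊(r : ℝ)⌋₊ + 1) ↔ (n : ℝ) ≤ r := by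
    rw [Finset.mem_range, Nat.lt_succ_iff, Nat.le_floor_iff r.coe_nonneg]
  have hneg : HasSum (fun n : ℕ ↦ Real.exp (-r) * r ^ n / (n)! * max ((r : ℝ) - n) 0)
      (r * (Real.exp (-r) * r ^ ⌊(r : ℝ)⌋₊ / (⌊(r : ℝ)⌋₊)!)) := by
    rw [← sum_range_poisson_sub, Finset.sum_congr rfl fun n hn ↦ by
      rw [← max_eq_left (sub_nonneg.2 ((hlt n).1 hn))]]
    refine hasSum_sum_of_ne_finset_zero fun n hn ↦ ?_
    rw [hlt, not_le] at hn
    rw [max_eq_right (by linarith), mul_zero]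
  have h := ((hasSum_poisson_natCast r).sub
    ((hasSum_one_poissonMeasure r).mul_left (r : ℝ))).add (hneg.mul_left 2)
  rw [mul_one, sub_self, zero_add] at h
  refine h.congr_fun fun n ↦ ?_
  rcases le_total (n : ℝ) r with hn | hn
  · rw [abs_of_nonpos (by linarith), max_eq_left (by linarith)]
    ring
  · rw [abs_of_nonneg (by linarith), max_eq_right (by linarith)]
    ring

theorem factorial_le_exp_one_mul_sqrt {k : ℕ} (hk : k ≠ 0) :
    ((k)! : ℝ) ≤ Real.exp 1 * √k * (k / Real.exp 1) ^ k := by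
  obtain ⟨j, rfl⟩ := Nat.exists_eq_succ_of_ne_zero hk
  have h := Stirling.stirlingSeq'_antitone (Nat.zero_le j)
  simp only [Function.comp, Nat.succ_eq_add_one, zero_add, Stirling.stirlingSeq_one] at h
  rw [Stirling.stirlingSeq, div_le_iff₀ (by positivity), Real.sqrt_mul (by norm_num)] at h
  refine h.trans_eq ?_
  field_simp

theorem sqrt_div_exp_one_le {r : ℝ} (hr : 1 ≤ r) :
    √r / Real.exp 1 ≤ r * (Real.exp (-r) * r ^ ⌊r⌋₊ / (⌊r⌋₊)!) := by
  have hk : ⌊r⌋₊ ≠ 0 := (Nat.floor_pos.2 hr).ne'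
  have hkr : (⌊r⌋₊ : ℝ) ≤ r := Nat.floor_le (by linarith)
  have hrk : r ≤ ⌊r⌋₊ + 1 := (Nat.lt_floor_add_one r).le
  generalize ⌊r⌋₊ = k at hk hkr hrk
  have hk0 : (0 : ℝ) < k := by positivity
  have hr0 : 0 < r := by linarith
  set L := Real.log (r / k) with hL
  have hrL : r = k * Real.exp L := by
    rw [hL, Real.exp_log (by positivity)]
    field_simp
  have hLle : r - k ≤ k * L + L / 2 := by
    have h := Real.le_log_one_add_of_nonneg (x := (r - k) / k)
      (div_nonneg (by linarith) hk0.le)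
    rw [show 1 + (r - k) / k = r / k by field_simp; ring, ← hL,
      show 2 * ((r - k) / k) / ((r - k) / k + 2) = 2 * (r - k) / (r + k) by
        rw [show (r - k) / k + 2 = (r + k) / k by field_simp; ring]
        field_simp,
      div_le_iff₀ (by positivity)] at h
    have hL0 : 0 ≤ L := Real.log_nonneg ((one_le_div hk0).2 hkr)
    nlinarith
  have hsqrt : √r = √k * Real.exp (L / 2) := by
    rw [hrL, Real.sqrt_mul hk0.le, ← Real.exp_half]
  have hpow : r ^ k = (k : ℝ) ^ k * Real.exp (k * L) := by
    conv_lhs => rw [hrL, mul_pow, ← Real.exp_nat_mul]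
  have key : ((k)! : ℝ) ≤ Real.exp 1 * (√r * (Real.exp (-r) * r ^ k)) := by
    refine (factorial_le_exp_one_mul_sqrt hk).trans ?_
    rw [hsqrt, hpow, div_pow, ← Real.exp_nat_mul, mul_one, div_eq_mul_inv, ← Real.exp_neg]
    have hexp : Real.exp (-k) ≤ Real.exp (L / 2) * Real.exp (-r) * Real.exp (k * L) := by
      rw [← Real.exp_add, ← Real.exp_add]
      exact Real.exp_le_exp.2 (by linarith)
    calc _ = Real.exp 1 * √k * (k : ℝ) ^ k * Real.exp (-k) := by ring
      _ ≤ Real.exp 1 * √k * (k : ℝ) ^ k *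
          (Real.exp (L / 2) * Real.exp (-r) * Real.exp (k * L)) := by gcongr
      _ = _ := by ring
  rw [← mul_div_assoc, div_le_div_iff₀ (by positivity) (by positivity)]
  calc √r * (k)! ≤ √r * (Real.exp 1 * (√r * (Real.exp (-r) * r ^ k))) := by gcongr
    _ = (√r * √r) * (Real.exp (-r) * r ^ k) * Real.exp 1 := by ring
    _ = _ := by rw [Real.mul_self_sqrt hr0.le]

theorem integral_abs_sub_poissonMeasure (r : ℝ≥0) :
    ∫ n : ℕ, |(n : ℝ) - r| ∂(poissonMeasure r) =
      2 * (r * (Real.exp (-r) * r ^ ⌊(r : ℝ)⌋₊ / (⌊(r : ℝ)⌋₊)!)) := by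
  rw [integral_poissonMeasure]
  exact (hasSum_poisson_abs_sub r).tsum_eq

theorem integral_sub_sq_poissonMeasure (r : ℝ≥0) :
    ∫ n : ℕ, ((n : ℝ) - r) ^ 2 ∂(poissonMeasure r) = r := by
  rw [integral_poissonMeasure]
  exact (hasSum_poisson_sub_sq r).tsum_eq

theorem memLp_abs_sub_poissonMeasure (r : ℝ≥0) :
    MemLp (fun n : ℕ ↦ |(n : ℝ) - r|) 2 (poissonMeasure r) := by
  rw [memLp_two_iff_integrable_sq .of_discrete, integrable_poissonMeasure_iff]
  simpa using (hasSum_poisson_sub_sq r).summable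

theorem variance_abs_sub_poissonMeasure_le (r : ℝ≥0) :
    variance (fun n : ℕ ↦ |(n : ℝ) - r|) (poissonMeasure r) ≤ r := by
  refine (variance_le_expectation_sq .of_discrete).trans_eq ?_
  simpa using integral_sub_sq_poissonMeasure r

end PoissonAbsDev

/-- Let `m, N` be positive integers with `λ = m/N ≥ 2`, let
`c₁ = 1/(√π e^{1/12})`, and let `Y_1, …, Y_N` be independent Poisson random
variables with parameter `λ = m/N` (modelled by the product of `N` Poisson
measures on `ℕ`, with `Y j` the `j`-th coordinate). Then
`𝔼[∑_j |Y_j − m/N|] ≥ c₁ √(mN)` and `Var(∑_j |Y_j − m/N|) ≤ m`. -/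
theorem sum_poisson_abs_dev_mean_var {m N : ℕ} (hm : 0 < m) (hN : 0 < N)
    (hlam : 2 ≤ (m : ℝ) / N) :
    (1 / (Real.sqrt Real.pi * Real.exp (1 / 12))) * Real.sqrt (m * N) ≤
      (∫ y, (∑ j : Fin N, |(y j : ℝ) - (m : ℝ) / N|)
        ∂(Measure.pi fun _ : Fin N => poissonMeasure ((m : ℝ≥0) / N))) ∧
    variance (fun y : Fin N → ℕ => ∑ j : Fin N, |(y j : ℝ) - (m : ℝ) / N|)
        (Measure.pi fun _ : Fin N => poissonMeasure ((m : ℝ≥0) / N)) ≤ m := by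
  set r : ℝ≥0 := (m : ℝ≥0) / N with hr
  have hrR : (m : ℝ) / N = r := by simp [hr]
  have hN0 : (0 : ℝ) < N := by exact_mod_cast hN
  have hmR : (m : ℝ) = N * r := by rw [← hrR]; field_simp
  rw [hrR] at hlam
  simp only [hrR]
  have hL2 := PoissonAbsDev.memLp_abs_sub_poissonMeasure r
  constructor
  · have hintegrable (j : Fin N) : Integrable (fun y : Fin N → ℕ ↦ |(y j : ℝ) - r|)
        (Measure.pi fun _ : Fin N ↦ poissonMeasure r) :=
      (measurePreserving_eval (fun _ : Fin N ↦ poissonMeasure r) j).integrable_comp_of_integrable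
        (hL2.integrable one_le_two)
    rw [integral_finsetSum _ fun j _ ↦ hintegrable j]
    have hint (j : Fin N) : ∫ y : Fin N → ℕ, |(y j : ℝ) - r|
        ∂(Measure.pi fun _ : Fin N ↦ poissonMeasure r) =
          2 * (r * (Real.exp (-r) * r ^ ⌊(r : ℝ)⌋₊ / (⌊(r : ℝ)⌋₊).factorial)) := by
      have hmp := measurePreserving_eval (fun _ : Fin N ↦ poissonMeasure r) j
      rw [← PoissonAbsDev.integral_abs_sub_poissonMeasure, ← hmp.map_eq,
        integral_map hmp.aemeasurable .of_discrete, hmp.map_eq]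
    simp only [hint, Finset.sum_const, Finset.card_univ, Fintype.card_fin, nsmul_eq_mul]
    have hbound := PoissonAbsDev.sqrt_div_exp_one_le (r := r) (by linarith)
    have hsqrt : √((m : ℝ) * N) = N * √r := by
      rw [hmR, show (N : ℝ) * r * N = N ^ 2 * r by ring, Real.sqrt_mul (by positivity),
        Real.sqrt_sq hN0.le]
    have hconst : 1 / (√Real.pi * Real.exp (1 / 12)) ≤ 2 / Real.exp 1 := by
      have hpi : (3 / 2 : ℝ) ≤ √Real.pi :=
        Real.le_sqrt_of_sq_le (by linarith [Real.pi_gt_three])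
      have hexp : (1 : ℝ) ≤ Real.exp (1 / 12) := Real.one_le_exp (by norm_num)
      rw [div_le_div_iff₀ (by positivity) (by positivity)]
      nlinarith [Real.exp_one_lt_d9]
    calc _ ≤ 2 / Real.exp 1 * (N * √r) := by rw [hsqrt]; gcongr
      _ = N * (2 * (√r / Real.exp 1)) := by ring
      _ ≤ _ := by gcongr
  · have hvar := variance_sum_pi (μ := fun _ : Fin N ↦ poissonMeasure r) fun _ ↦ hL2
    have hfun : (∑ j : Fin N, fun y : Fin N → ℕ ↦ |(y j : ℝ) - r|) =
        fun y ↦ ∑ j : Fin N, |(y j : ℝ) - r| := by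
      ext y
      simp
    rw [hfun] at hvar
    rw [hvar, Finset.sum_const, Finset.card_univ, Fintype.card_fin, nsmul_eq_mul, hmR]
    gcongr
    exact PoissonAbsDev.variance_abs_sub_poissonMeasure_le r
end

section
/- Let m, N be positive integers with λ = m/N ≥ 2, let c₁ = 1/(√π · e^{1/12}), let ε > 0 satisfy 2mε < c₁·√(mN) (which holds in particular when m < (c₁²/(4ε²))·N), and let Y_1, ..., Y_N be independent Poisson random variables each with parameter m/N. Then Pr[Σ_{j=1}^N |Y_j − m/N| < 2mε] ≤ m/(c₁·√(mN) − 2mε)². -/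
open MeasureTheory ProbabilityTheory
open scoped ENNReal NNReal

lemma cast_descFactorial_succ_real (n k : ℕ) :
    (n.descFactorial (k + 1) : ℝ) = ((n : ℝ) - k) * n.descFactorial k := by
  rcases le_or_gt k n with h | h
  · rw [Nat.descFactorial_succ, Nat.cast_mul, Nat.cast_sub h]
  · simp [Nat.descFactorial_of_lt h]

lemma hasSum_descFactorial_poisson (r : ℝ≥0) (k : ℕ) :
    HasSum (fun n : ℕ => Real.exp (-r) * (r : ℝ) ^ n / n.factorial * n.descFactorial k)
      ((r : ℝ) ^ k) := by
  have hzero : ∑ n ∈ Finset.range k,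
      Real.exp (-r) * (r : ℝ) ^ n / n.factorial * n.descFactorial k = 0 :=
    Finset.sum_eq_zero fun n hn => by
      simp [Nat.descFactorial_of_lt (Finset.mem_range.1 hn)]
  refine (hasSum_nat_add_iff' k).1 ?_
  rw [hzero, sub_zero, ← mul_one ((r : ℝ) ^ k)]
  convert! (hasSum_one_poissonMeasure r).mul_left ((r : ℝ) ^ k) using 2 with n
  have h := Nat.factorial_mul_descFactorial (Nat.le_add_left k n)
  rw [Nat.add_sub_cancel] at h
  have hd : ((n + k).descFactorial k : ℝ) ≠ 0 := fun h0 => by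
    rw [Nat.cast_eq_zero] at h0
    rw [h0, mul_zero] at h
    exact (Nat.factorial_ne_zero _) h.symm
  rw [← h, Nat.cast_mul, pow_add]
  field_simp

lemma integrable_descFactorial_poisson (r : ℝ≥0) (k : ℕ) :
    Integrable (fun n : ℕ => (n.descFactorial k : ℝ)) (poissonMeasure r) := by
  rw [integrable_poissonMeasure_iff]
  simpa using (hasSum_descFactorial_poisson r k).summable

lemma integral_descFactorial_poisson (r : ℝ≥0) (k : ℕ) :
    ∫ n : ℕ, (n.descFactorial k : ℝ) ∂(poissonMeasure r) = (r : ℝ) ^ k :=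
  (hasSum_integral_poissonMeasure (integrable_descFactorial_poisson r k)).unique
    (hasSum_descFactorial_poisson r k)

lemma integrable_sum_descFactorial_poisson (r : ℝ≥0) (s : Finset ℕ) (a : ℕ → ℝ) :
    Integrable (fun n : ℕ => ∑ k ∈ s, a k * n.descFactorial k) (poissonMeasure r) :=
  integrable_finsetSum _ fun k _ => (integrable_descFactorial_poisson r k).const_mul (a k)

lemma integral_sum_descFactorial_poisson (r : ℝ≥0) (s : Finset ℕ) (a : ℕ → ℝ) :
    ∫ n : ℕ, ∑ k ∈ s, a k * n.descFactorial k ∂(poissonMeasure r) =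
      ∑ k ∈ s, a k * (r : ℝ) ^ k := by
  rw [integral_finsetSum _ fun k _ => (integrable_descFactorial_poisson r k).const_mul (a k)]
  simp_rw [integral_const_mul, integral_descFactorial_poisson]

lemma sub_sq_eq_sum_descFactorial (l : ℝ) (n : ℕ) :
    ((n : ℝ) - l) ^ 2 =
      ∑ k ∈ Finset.range 3, ![l ^ 2, 1 - 2 * l, 1] (Fin.ofNat 3 k) * n.descFactorial k := by
  simp [Finset.sum_range_succ, cast_descFactorial_succ_real, Fin.ofNat, -Nat.descFactorial_succ]
  ring

lemma sub_pow_four_eq_sum_descFactorial (l : ℝ) (n : ℕ) :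
    ((n : ℝ) - l) ^ 4 =
      ∑ k ∈ Finset.range 5,
        ![l ^ 4, 1 - 4 * l + 6 * l ^ 2 - 4 * l ^ 3, 7 - 12 * l + 6 * l ^ 2, 6 - 4 * l, 1]
          (Fin.ofNat 5 k) * n.descFactorial k := by
  simp [Finset.sum_range_succ, cast_descFactorial_succ_real, Fin.ofNat, -Nat.descFactorial_succ]
  ring

lemma integrable_sub_sq_poisson (r : ℝ≥0) (l : ℝ) :
    Integrable (fun n : ℕ => ((n : ℝ) - l) ^ 2) (poissonMeasure r) := by
  simp_rw [sub_sq_eq_sum_descFactorial]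
  exact integrable_sum_descFactorial_poisson r _ fun k => ![l ^ 2, 1 - 2 * l, 1] (Fin.ofNat 3 k)

lemma integral_sub_sq_poisson (r : ℝ≥0) :
    ∫ n : ℕ, ((n : ℝ) - r) ^ 2 ∂(poissonMeasure r) = r := by
  simp_rw [sub_sq_eq_sum_descFactorial]
  rw [integral_sum_descFactorial_poisson r _
    fun k => ![(r : ℝ) ^ 2, 1 - 2 * r, 1] (Fin.ofNat 3 k)]
  simp [Finset.sum_range_succ, Fin.ofNat]
  ring

lemma integrable_sub_pow_four_poisson (r : ℝ≥0) (l : ℝ) :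
    Integrable (fun n : ℕ => ((n : ℝ) - l) ^ 4) (poissonMeasure r) := by
  simp_rw [sub_pow_four_eq_sum_descFactorial]
  exact integrable_sum_descFactorial_poisson r _ fun k =>
    ![l ^ 4, 1 - 4 * l + 6 * l ^ 2 - 4 * l ^ 3, 7 - 12 * l + 6 * l ^ 2, 6 - 4 * l, 1] (Fin.ofNat 5 k)

lemma integral_sub_pow_four_poisson (r : ℝ≥0) :
    ∫ n : ℕ, ((n : ℝ) - r) ^ 4 ∂(poissonMeasure r) = 3 * (r : ℝ) ^ 2 + r := by
  simp_rw [sub_pow_four_eq_sum_descFactorial]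
  rw [integral_sum_descFactorial_poisson r _ fun k =>
    ![(r : ℝ) ^ 4, 1 - 4 * (r : ℝ) + 6 * (r : ℝ) ^ 2 - 4 * (r : ℝ) ^ 3,
      7 - 12 * (r : ℝ) + 6 * (r : ℝ) ^ 2, 6 - 4 * (r : ℝ), 1] (Fin.ofNat 5 k)]
  simp [Finset.sum_range_succ, Fin.ofNat]
  ring

lemma memLp_two_abs_sub_poisson (r : ℝ≥0) (l : ℝ) :
    MemLp (fun n : ℕ => |(n : ℝ) - l|) 2 (poissonMeasure r) := by
  rw [memLp_two_iff_integrable_sq (by fun_prop)]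
  simpa only [sq_abs] using integrable_sub_sq_poisson r l

lemma variance_abs_sub_poisson_le (r : ℝ≥0) :
    Var[fun n : ℕ => |(n : ℝ) - r|; poissonMeasure r] ≤ r := by
  refine (variance_le_expectation_sq (by fun_prop)).trans_eq ?_
  simp only [Pi.pow_apply, sq_abs]
  exact integral_sub_sq_poisson r

lemma quartic_le_abs (x : ℝ) {s : ℝ} (hs : 0 < s) :
    3 / (2 * s) * x ^ 2 - 1 / (2 * s ^ 3) * x ^ 4 ≤ |x| := by
  have h2 : x ^ 2 = |x| ^ 2 := (sq_abs x).symm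
  have h4 : x ^ 4 = |x| ^ 4 := by rw [pow_mul x 2 2, pow_mul |x| 2 2, sq_abs]
  have key : |x| - (3 / (2 * s) * |x| ^ 2 - 1 / (2 * s ^ 3) * |x| ^ 4) =
      |x| * (|x| - s) ^ 2 * (|x| + 2 * s) / (2 * s ^ 3) := by
    field_simp
    ring
  rw [h2, h4, ← sub_nonneg, key]
  positivity

lemma sqrt_le_integral_abs_sub_poisson {r : ℝ≥0} (hr : 2 ≤ r) :
    Real.sqrt r / Real.sqrt (7 / 2) ≤ ∫ n : ℕ, |(n : ℝ) - r| ∂(poissonMeasure r) := by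
  have hr' : (2 : ℝ) ≤ r := by exact_mod_cast hr
  set s : ℝ := Real.sqrt (7 / 2 * r) with hs_def
  have hs : 0 < s := Real.sqrt_pos.2 (by positivity)
  have hs2 : s ^ 2 = 7 / 2 * r := Real.sq_sqrt (by positivity)
  have hsqrt : Real.sqrt r / Real.sqrt (7 / 2) = r / s := by
    rw [hs_def, Real.sqrt_mul (by norm_num), mul_comm, ← div_div, Real.div_sqrt]
  have h2 := (integrable_sub_sq_poisson r r).const_mul (3 / (2 * s))
  have h4 := (integrable_sub_pow_four_poisson r r).const_mul (1 / (2 * s ^ 3))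
  calc Real.sqrt r / Real.sqrt (7 / 2) = r / s := hsqrt
    _ ≤ 3 / (2 * s) * r - 1 / (2 * s ^ 3) * (3 * (r : ℝ) ^ 2 + r) := by
      have key : 3 / (2 * s) * r - 1 / (2 * s ^ 3) * (3 * (r : ℝ) ^ 2 + r) - r / s =
          (s ^ 2 * r - (3 * (r : ℝ) ^ 2 + r)) / (2 * s ^ 3) := by
        field_simp
        ring
      rw [← sub_nonneg, key, hs2]
      exact div_nonneg (by nlinarith) (by positivity)
    _ = ∫ n : ℕ, (3 / (2 * s) * ((n : ℝ) - r) ^ 2 - 1 / (2 * s ^ 3) * ((n : ℝ) - r) ^ 4)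
          ∂(poissonMeasure r) := by
      rw [integral_sub h2 h4, integral_const_mul, integral_const_mul, integral_sub_sq_poisson,
        integral_sub_pow_four_poisson]
    _ ≤ _ := integral_mono (h2.sub h4)
        ((memLp_two_abs_sub_poisson r r).integrable one_le_two) fun n => quartic_le_abs _ hs

lemma one_div_sqrt_pi_mul_exp_le :
    1 / (Real.sqrt Real.pi * Real.exp (1 / 12)) ≤ 1 / Real.sqrt (7 / 2) := by
  refine one_div_le_one_div_of_le (by positivity) ((Real.sqrt_le_left (by positivity)).2 ?_)
  rw [mul_pow, Real.sq_sqrt Real.pi_pos.le, ← Real.exp_nat_mul]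
  have h1 := Real.add_one_le_exp (((2 : ℕ) : ℝ) * (1 / 12))
  have h2 := Real.pi_gt_three
  norm_num at h1 ⊢
  nlinarith

/-- Let `m, N` be positive integers with `λ = m/N ≥ 2`, let
`c₁ = 1/(√π e^{1/12})`, let `ε > 0` satisfy `2mε < c₁ √(mN)`, and let
`Y_1, …, Y_N` be independent Poisson random variables with parameter `m/N`.
Then `Pr[∑_j |Y_j − m/N| < 2mε] ≤ m / (c₁ √(mN) − 2mε)²`. -/
theorem sum_poisson_abs_dev_prob_le {m N : ℕ} (hm : 0 < m) (hN : 0 < N)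
    (hlam : 2 ≤ (m : ℝ) / N) (ε : ℝ) (hε : 0 < ε)
    (hsmall : 2 * m * ε <
      (1 / (Real.sqrt Real.pi * Real.exp (1 / 12))) * Real.sqrt (m * N)) :
    (Measure.pi fun _ : Fin N => poissonMeasure ((m : ℝ≥0) / N))
        {y | ∑ j : Fin N, |(y j : ℝ) - (m : ℝ) / N| < 2 * m * ε}
      ≤ ENNReal.ofReal ((m : ℝ) /
          ((1 / (Real.sqrt Real.pi * Real.exp (1 / 12))) * Real.sqrt (m * N)
            - 2 * m * ε) ^ 2) := by
  set c := 1 / (Real.sqrt Real.pi * Real.exp (1 / 12))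
  set r : ℝ≥0 := (m : ℝ≥0) / N with hr_def
  have hr : (r : ℝ) = (m : ℝ) / N := by simp [hr_def]
  have hN' : (0 : ℝ) < N := by exact_mod_cast hN
  have hNr : (N : ℝ) * r = m := by rw [hr]; field_simp
  have hr2 : 2 ≤ r := by
    rw [← NNReal.coe_le_coe, hr]
    exact_mod_cast hlam
  set μ := Measure.pi fun _ : Fin N => poissonMeasure r
  rw [← hr]
  let X : Fin N → ℕ → ℝ := fun _ n => |(n : ℝ) - r|
  have hX (j : Fin N) : MemLp (X j) 2 (poissonMeasure r) := memLp_two_abs_sub_poisson r r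
  have hXμ (j : Fin N) : MemLp (fun y : Fin N → ℕ => X j (y j)) 2 μ :=
    (hX j).comp_measurePreserving (measurePreserving_eval _ j)
  have hS : MemLp (∑ j, fun y : Fin N → ℕ => X j (y j)) 2 μ :=
    memLp_finsetSum' _ fun j _ => hXμ j
  have hvar : Var[∑ j, fun y : Fin N → ℕ => X j (y j); μ] ≤ m := by
    rw [variance_sum_pi hX]
    refine (Finset.sum_le_sum fun j _ => variance_abs_sub_poisson_le r).trans_eq ?_
    simp [hNr]
  have hmean : c * Real.sqrt (m * N) ≤ μ[∑ j, fun y : Fin N → ℕ => X j (y j)] := by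
    simp only [Finset.sum_apply]
    rw [integral_finsetSum _ fun j _ => (hXμ j).integrable one_le_two]
    have hj (j : Fin N) : ∫ y, X j (y j) ∂μ = ∫ n : ℕ, |(n : ℝ) - r| ∂(poissonMeasure r) :=
      integral_comp_eval (hX j).aestronglyMeasurable
    simp_rw [hj]
    have hsq : Real.sqrt (m * N) = N * Real.sqrt r := by
      rw [← hNr, show (N : ℝ) * r * N = (N : ℝ) ^ 2 * r by ring, Real.sqrt_mul (by positivity),
        Real.sqrt_sq hN'.le]
    rw [Finset.sum_const, Finset.card_univ, Fintype.card_fin, nsmul_eq_mul, hsq, mul_left_comm]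
    gcongr
    calc c * Real.sqrt r ≤ 1 / Real.sqrt (7 / 2) * Real.sqrt r := by
          gcongr
          exact one_div_sqrt_pi_mul_exp_le
      _ = Real.sqrt r / Real.sqrt (7 / 2) := by ring
      _ ≤ _ := sqrt_le_integral_abs_sub_poisson hr2
  have hd : 0 < c * Real.sqrt (m * N) - 2 * m * ε := sub_pos.2 hsmall
  refine (measure_mono fun y hy => ?_).trans ((meas_ge_le_variance_div_sq hS hd).trans
    (ENNReal.ofReal_le_ofReal (by gcongr)))
  have hy' : (∑ j, fun y : Fin N → ℕ => X j (y j)) y < 2 * m * ε := by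
    rw [Finset.sum_apply]
    exact hy
  rw [Set.mem_ofPred_eq, abs_sub_comm]
  exact (by linarith : _ ≤ _).trans (le_abs_self _)
end

section
/- Let c₁ = 1/(√π · e^{1/12}) and let c be a constant with 0 < c < c₁²/16. Let m, N, ε be such that m = c·N/ε² and m/N ≥ 2, and let Y_1, ..., Y_N be independent Poisson random variables each with parameter m/N. Then Pr[Σ_{j=1}^N |Y_j − m/N| < 2mε] ≤ (4/c₁²)·(1/N). -/
open MeasureTheory ProbabilityTheory
open scoped ENNReal NNReal

namespace PoissonAbsDev

lemma cast_descFactorial_succ (n k : ℕ) :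
    (n.descFactorial (k + 1) : ℝ) = (n - k) * n.descFactorial k := by
  rcases le_or_gt k n with h | h
  · rw [Nat.descFactorial_succ, Nat.cast_mul, Nat.cast_sub h]
  · rw [Nat.descFactorial_of_lt h, Nat.descFactorial_of_lt (h.trans k.lt_succ_self)]
    simp

lemma hasSum_descFactorial_poisson (r : ℝ≥0) (k : ℕ) :
    HasSum (fun n : ℕ => Real.exp (-r) * (r : ℝ) ^ n / n.factorial * n.descFactorial k)
      ((r : ℝ) ^ k) := by
  have hzero : ∑ i ∈ Finset.range k,
      Real.exp (-r) * (r : ℝ) ^ i / i.factorial * i.descFactorial k = 0 :=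
    Finset.sum_eq_zero fun i hi => by
      rw [Nat.descFactorial_of_lt (Finset.mem_range.mp hi)]; simp
  rw [← hasSum_nat_add_iff' k, hzero, sub_zero]
  have h := (hasSum_one_poissonMeasure r).mul_left ((r : ℝ) ^ k)
  rw [mul_one] at h
  convert! h using 2 with n
  have hfac : ((n + k).factorial : ℝ) = n.factorial * (n + k).descFactorial k := by
    have := Nat.factorial_mul_descFactorial (Nat.le_add_left k n)
    rw [Nat.add_sub_cancel] at this
    exact_mod_cast this.symm
  have hd : ((n + k).descFactorial k : ℝ) ≠ 0 := by
    exact_mod_cast (Nat.descFactorial_pos.mpr (Nat.le_add_left k n)).ne'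
  rw [hfac, pow_add]
  field_simp

lemma integrable_descFactorial_poisson (r : ℝ≥0) (k : ℕ) :
    Integrable (fun n : ℕ => (n.descFactorial k : ℝ)) (poissonMeasure r) := by
  rw [integrable_poissonMeasure_iff]
  simpa using (hasSum_descFactorial_poisson r k).summable

/-- The `k`-th factorial moment of a Poisson variable of rate `r` is `r ^ k`. -/
lemma integral_descFactorial_poisson (r : ℝ≥0) (k : ℕ) :
    ∫ n : ℕ, (n.descFactorial k : ℝ) ∂poissonMeasure r = (r : ℝ) ^ k := by
  rw [integral_poissonMeasure]
  exact (hasSum_descFactorial_poisson r k).tsum_eq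

lemma sub_sq_eq_descFactorial (n : ℕ) (r : ℝ) :
    ((n : ℝ) - r) ^ 2 = n.descFactorial 2 + (1 - 2 * r) * n.descFactorial 1
      + r ^ 2 * n.descFactorial 0 := by
  simp only [cast_descFactorial_succ, Nat.descFactorial_zero]
  push_cast
  ring

lemma sub_pow_four_eq_descFactorial (n : ℕ) (r : ℝ) :
    ((n : ℝ) - r) ^ 4 = n.descFactorial 4 + (6 - 4 * r) * n.descFactorial 3
      + (7 - 12 * r + 6 * r ^ 2) * n.descFactorial 2
      + (1 - 4 * r + 6 * r ^ 2 - 4 * r ^ 3) * n.descFactorial 1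
      + r ^ 4 * n.descFactorial 0 := by
  simp only [cast_descFactorial_succ, Nat.descFactorial_zero]
  push_cast
  ring

lemma integrable_sub_sq_poisson (r : ℝ≥0) :
    Integrable (fun n : ℕ => ((n : ℝ) - r) ^ 2) (poissonMeasure r) := by
  have h := integrable_descFactorial_poisson r
  simp only [sub_sq_eq_descFactorial]
  exact ((h 2).add ((h 1).const_mul _)).add ((h 0).const_mul _)

lemma integrable_sub_pow_four_poisson (r : ℝ≥0) :
    Integrable (fun n : ℕ => ((n : ℝ) - r) ^ 4) (poissonMeasure r) := by
  have h := integrable_descFactorial_poisson r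
  simp only [sub_pow_four_eq_descFactorial]
  exact ((((h 4).add ((h 3).const_mul _)).add ((h 2).const_mul _)).add
    ((h 1).const_mul _)).add ((h 0).const_mul _)

/-- The variance of a Poisson variable. -/
lemma integral_sub_sq_poisson (r : ℝ≥0) :
    ∫ n : ℕ, ((n : ℝ) - r) ^ 2 ∂poissonMeasure r = r := by
  have h := hasSum_descFactorial_poisson r
  rw [integral_poissonMeasure]
  refine HasSum.tsum_eq ?_
  convert! ((h 2).add ((h 1).mul_left (1 - 2 * (r : ℝ)))).add ((h 0).mul_left ((r : ℝ) ^ 2)) using 1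
  · ext n
    rw [smul_eq_mul, sub_sq_eq_descFactorial]
    ring
  · ring

/-- The fourth central moment of a Poisson variable. -/
lemma integral_sub_pow_four_poisson (r : ℝ≥0) :
    ∫ n : ℕ, ((n : ℝ) - r) ^ 4 ∂poissonMeasure r = 3 * (r : ℝ) ^ 2 + r := by
  have h := hasSum_descFactorial_poisson r
  rw [integral_poissonMeasure]
  refine HasSum.tsum_eq ?_
  convert! ((((h 4).add ((h 3).mul_left (6 - 4 * (r : ℝ)))).add
    ((h 2).mul_left (7 - 12 * (r : ℝ) + 6 * (r : ℝ) ^ 2))).add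
    ((h 1).mul_left (1 - 4 * (r : ℝ) + 6 * (r : ℝ) ^ 2 - 4 * (r : ℝ) ^ 3))).add
    ((h 0).mul_left ((r : ℝ) ^ 4)) using 1
  · ext n
    rw [smul_eq_mul, sub_pow_four_eq_descFactorial]
    ring
  · ring

lemma memLp_abs_sub_poisson (r : ℝ≥0) :
    MemLp (fun n : ℕ => |(n : ℝ) - r|) 2 (poissonMeasure r) := by
  rw [memLp_two_iff_integrable_sq .of_discrete]
  simpa only [sq_abs] using integrable_sub_sq_poisson r

lemma variance_abs_sub_poisson_le (r : ℝ≥0) :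
    variance (fun n : ℕ => |(n : ℝ) - r|) (poissonMeasure r) ≤ r := by
  refine (variance_le_expectation_sq .of_discrete).trans_eq ?_
  simpa only [Pi.pow_apply, sq_abs] using integral_sub_sq_poisson r

lemma quartic_le_abs (x : ℝ) {s : ℝ} (hs : 0 < s) :
    (2 * s ^ 3)⁻¹ * (3 * s ^ 2 * x ^ 2 - x ^ 4) ≤ |x| := by
  rw [inv_mul_le_iff₀ (by positivity)]
  have h : 0 ≤ |x| * (|x| - s) ^ 2 * (|x| + 2 * s) := by positivity
  have h2 := sq_abs x
  have h4 : x ^ 4 = |x| ^ 4 := by rw [← abs_pow, abs_of_nonneg (by positivity)]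
  rw [h4, ← h2]
  nlinarith

/-- A lower bound on the mean absolute deviation, from the second and fourth moments. -/
lemma div_sqrt_le_integral_abs_sub_poisson (r : ℝ≥0) :
    (r : ℝ) / √(3 * r + 1) ≤ ∫ n : ℕ, |(n : ℝ) - r| ∂poissonMeasure r := by
  obtain ⟨s, hs_def⟩ : ∃ s, s = √(3 * (r : ℝ) + 1) := ⟨_, rfl⟩
  have hs : 0 < s := by rw [hs_def]; positivity
  have hs2 : s ^ 2 = 3 * r + 1 := by rw [hs_def]; exact Real.sq_sqrt (by positivity)
  rw [← hs_def]
  have h2 := (integrable_sub_sq_poisson r).const_mul (3 * s ^ 2)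
  have h4 := integrable_sub_pow_four_poisson r
  have heq : ∫ n : ℕ, (2 * s ^ 3)⁻¹ * (3 * s ^ 2 * ((n : ℝ) - r) ^ 2 - ((n : ℝ) - r) ^ 4)
      ∂poissonMeasure r = r / s := by
    rw [integral_const_mul, integral_sub h2 h4, integral_const_mul,
      integral_sub_sq_poisson, integral_sub_pow_four_poisson,
      show 3 * (r : ℝ) ^ 2 + r = s ^ 2 * r by rw [hs2]; ring]
    field_simp
    ring
  rw [← heq]
  exact integral_mono ((h2.sub h4).const_mul _)
    ((memLp_abs_sub_poisson r).integrable (by norm_num)) fun n => quartic_le_abs _ hs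

lemma sq_const_le : (1 / (√Real.pi * Real.exp (1 / 12))) ^ 2 ≤ (2 / 7 : ℝ) := by
  have hexp : (Real.exp (1 / 12)) ^ 2 = Real.exp (1 / 6) := by
    rw [← Real.exp_nat_mul]; norm_num
  rw [div_pow, mul_pow, Real.sq_sqrt Real.pi_pos.le, hexp, one_pow,
    div_le_div_iff₀ (by positivity) (by norm_num)]
  nlinarith [Real.pi_gt_three, Real.add_one_le_exp (1 / 6 : ℝ)]

/-- For rate at least `2`, the mean absolute deviation is at least `a √r` when `a² ≤ 2/7`. -/
lemma mul_sqrt_le_integral_abs_sub_poisson {r : ℝ≥0} (hr : 2 ≤ (r : ℝ)) {a : ℝ}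
    (ha2 : a ^ 2 ≤ 2 / 7) :
    a * √r ≤ ∫ n : ℕ, |(n : ℝ) - r| ∂poissonMeasure r := by
  refine le_trans ?_ (div_sqrt_le_integral_abs_sub_poisson r)
  refine le_of_abs_le (abs_le_of_sq_le_sq ?_ ?_)
  · rw [div_pow, mul_pow, Real.sq_sqrt (by positivity), Real.sq_sqrt (by positivity),
      le_div_iff₀ (by positivity)]
    nlinarith [mul_le_mul_of_nonneg_right ha2 (show (0 : ℝ) ≤ r * (3 * r + 1) by positivity)]
  · positivity

/-- Chebyshev's inequality for the total absolute deviation of independent Poisson variables. -/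
lemma pi_poisson_sum_abs_sub_lt_le {N : ℕ} (hN : 0 < N) {r : ℝ≥0} (hr : 2 ≤ (r : ℝ)) {a t : ℝ}
    (ha : 0 < a) (ha2 : a ^ 2 ≤ 2 / 7) (ht : t ≤ N * (a * √r) / 2) :
    (Measure.pi fun _ : Fin N => poissonMeasure r) {y | ∑ j : Fin N, |(y j : ℝ) - r| < t}
      ≤ ENNReal.ofReal (4 / a ^ 2 * (1 / N)) := by
  have hN' : (0 : ℝ) < N := by exact_mod_cast hN
  have hr' : (0 : ℝ) < r := by linarith
  set P := Measure.pi fun _ : Fin N => poissonMeasure r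
  set f : ℕ → ℝ := fun n => |(n : ℝ) - r|
  set X : (Fin N → ℕ) → ℝ := ∑ j : Fin N, fun y => f (y j) with hX
  have hXapp (y : Fin N → ℕ) : X y = ∑ j, f (y j) := by simp [hX]
  have hmem (j : Fin N) : MemLp (fun y : Fin N → ℕ => f (y j)) 2 P :=
    (memLp_abs_sub_poisson r).comp_measurePreserving (measurePreserving_eval _ j)
  have hXmem : MemLp X 2 P := memLp_finsetSum' _ fun j _ => hmem j
  have hmean : ∫ y, X y ∂P = N * ∫ n, f n ∂poissonMeasure r := by
    simp only [hXapp]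
    rw [integral_finsetSum _ fun j _ => (hmem j).integrable (by norm_num)]
    have (j : Fin N) : ∫ y, f (y j) ∂P = ∫ n, f n ∂poissonMeasure r :=
      integral_comp_eval (μ := fun _ : Fin N => poissonMeasure r) (i := j) (f := f) .of_discrete
    simp [this]
  have hvar : variance X P ≤ N * r := by
    have h := variance_sum_pi (μ := fun _ : Fin N => poissonMeasure r) (X := fun _ => f)
      fun _ => memLp_abs_sub_poisson r
    rw [hX, h]
    simpa using mul_le_mul_of_nonneg_left (variance_abs_sub_poisson_le r) hN'.le
  have hmean' := mul_le_mul_of_nonneg_left (mul_sqrt_le_integral_abs_sub_poisson hr ha2) hN'.le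
  have hd : 0 < N * (a * √r) / 2 := by positivity
  calc P {y | ∑ j : Fin N, |(y j : ℝ) - r| < t}
      ≤ P {y | N * (a * √r) / 2 ≤ |X y - ∫ y, X y ∂P|} := by
        refine measure_mono fun y hy => ?_
        have hy' : X y < t := by rw [hXapp]; exact hy
        have habs := neg_le_abs (X y - ∫ y, X y ∂P)
        change _ ≤ |X y - ∫ y, X y ∂P|
        linarith
    _ ≤ ENNReal.ofReal (variance X P / (N * (a * √r) / 2) ^ 2) :=
        meas_ge_le_variance_div_sq hXmem hd
    _ ≤ _ := by
        refine ENNReal.ofReal_le_ofReal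
          ((div_le_div_of_nonneg_right hvar (by positivity)).trans_eq ?_)
        rw [div_pow, mul_pow, mul_pow, Real.sq_sqrt hr'.le]
        field_simp
        norm_num

end PoissonAbsDev

/-- Let `c₁ = 1/(√π e^{1/12})` and `0 < c < c₁²/16`. If `m = c N / ε²` and
`m/N ≥ 2`, and `Y_1, …, Y_N` are independent Poisson random variables with
parameter `m/N`, then `Pr[∑_j |Y_j − m/N| < 2mε] ≤ (4/c₁²)(1/N)`. -/
theorem sum_poisson_abs_dev_prob_le_of_m_eq {m N : ℕ} (hm : 0 < m) (hN : 0 < N)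
    (c ε : ℝ) (hε : 0 < ε)
    (hc : 0 < c ∧ c < (1 / (Real.sqrt Real.pi * Real.exp (1 / 12))) ^ 2 / 16)
    (hmeq : (m : ℝ) = c * N / ε ^ 2) (hlam : 2 ≤ (m : ℝ) / N) :
    (Measure.pi fun _ : Fin N => poissonMeasure ((m : ℝ≥0) / N))
        {y | ∑ j : Fin N, |(y j : ℝ) - (m : ℝ) / N| < 2 * m * ε}
      ≤ ENNReal.ofReal
          ((4 / (1 / (Real.sqrt Real.pi * Real.exp (1 / 12))) ^ 2) * (1 / N)) := by
  have hN' : (0 : ℝ) < N := by exact_mod_cast hN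
  have hcoe : (((m : ℝ≥0) / N : ℝ≥0) : ℝ) = (m : ℝ) / N := by simp
  set a := 1 / (√Real.pi * Real.exp (1 / 12))
  have ha : 0 < a := by positivity
  rw [← hcoe]
  refine PoissonAbsDev.pi_poisson_sum_abs_sub_lt_le hN (hcoe ▸ hlam) ha
    PoissonAbsDev.sq_const_le ?_
  refine le_of_abs_le (abs_le_of_sq_le_sq ?_ (by positivity))
  rw [hcoe, div_pow, mul_pow (N : ℝ), mul_pow a, Real.sq_sqrt (by positivity)]
  have hcm : (m : ℝ) * ε ^ 2 = c * N := by rw [hmeq]; field_simp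
  have hexp : (N : ℝ) ^ 2 * (a ^ 2 * (m / N)) / 2 ^ 2 = m * N * (a ^ 2 / 4) := by
    field_simp
    norm_num
  have hlhs : (2 * m * ε) ^ 2 = m * N * (4 * c) := by linear_combination 4 * (m : ℝ) * hcm
  rw [hexp, hlhs]
  exact mul_le_mul_of_nonneg_left (by linarith [hc.2]) (by positivity)
end
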